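/- Let X be a finite directed graph with edge set E of cardinality d, identify ℝ^d with the space of real-valued functions on E, let V ⊆ ℝ^d_{≥0} be a rational polyhedral cone contained in the non-negative orthant, and let h: ℝ^d → ℝ be a linear map with rational coefficients. For k ∈ ℤ_+ let D_k be the set of integer vectors v ∈ V with h(v) ∈ kℤ whose support (the set of edges on which v is positive) is nonempty and spans a connected subgraph of X. Then there exist M, p ∈ ℤ_+ such that for each congruence class mod p there are finitely many points v_1(k), …, v_s(k) ∈ V, each depending affine-linearly on k, with conv(D_k + V) = conv({v_1(k), …, v_s(k)} + V) for every k > M in that congruence class. -/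

import Mathlib

open scoped Pointwise

namespace SclPaper

/-- A rational convex polyhedral cone in `E → ℝ` (for a finite index type `E`): the set of
points where finitely many linear functionals with rational coefficients are non-negative. -/
def IsRationalPolyhedralCone {E : Type*} [Fintype E] [DecidableEq E] (C : Set (E → ℝ)) : Prop :=
  ∃ (m : ℕ) (f : Fin m → ((E → ℝ) →ₗ[ℝ] ℝ)),
    (∀ i e, ∃ q : ℚ, f i (Pi.single e 1) = (q : ℝ)) ∧
    C = {x | ∀ i, 0 ≤ f i x}

/-- The support of `x : E → ℝ` spans a connected subgraph of the directed graph with edge set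
`E` and endpoint maps `src`, `tgt`: any two edges in the support are linked by a chain of
edges of the support sharing endpoints. -/
def SupportConnected {Vt E : Type*} (src tgt : E → Vt) (x : E → ℝ) : Prop :=
  ∀ e₁ e₂ : E, x e₁ ≠ 0 → x e₂ ≠ 0 →
    Relation.ReflTransGen
      (fun e e' : E => x e ≠ 0 ∧ x e' ≠ 0 ∧
        ({src e, tgt e} ∩ {src e', tgt e'} : Set Vt).Nonempty) e₁ e₂

/-- The set `D_k` of integer vectors of `V` with `h`-value in `kℤ` and nonempty connected
support. -/
def Dlevel {Vt E : Type*} (src tgt : E → Vt) (V : Set (E → ℝ)) (h : (E → ℝ) →ₗ[ℝ] ℝ)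
    (k : ℕ) : Set (E → ℝ) :=
  {x | x ∈ V ∧ (∀ e, ∃ z : ℤ, x e = (z : ℝ)) ∧ (∃ z : ℤ, h x = (k : ℝ) * (z : ℝ)) ∧
    (∃ e, x e ≠ 0) ∧ SupportConnected src tgt x}

lemma clear_denoms {E : Type*} [Fintype E] [DecidableEq E] (F : (E → ℝ) →ₗ[ℝ] ℝ)
    (hF : ∀ e, ∃ q : ℚ, F (Pi.single e 1) = (q : ℝ)) :
    ∃ c : ℕ, 0 < c ∧ ∀ n : E → ℕ, ∃ z : ℤ, (c : ℝ) * F (fun e => (n e : ℝ)) = z := by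
  choose q hq using hF
  refine ⟨∏ e, (q e).den, Finset.prod_pos fun e _ => (q e).den_pos, fun n => ?_⟩
  have h1 : ∀ e, ∃ z : ℤ, ((∏ e, (q e).den : ℕ) : ℝ) * (q e : ℝ) = z := by
    intro e
    obtain ⟨d, hd⟩ := Finset.dvd_prod_of_mem (fun e => (q e).den) (Finset.mem_univ e)
    rw [hd]
    refine ⟨d * (q e).num, ?_⟩
    have h2 : ((q e).den : ℝ) * (q e : ℝ) = (q e).num := by
      exact_mod_cast Rat.den_mul_eq_num (q e)
    push_cast
    rw [← h2]; ring
  choose z hz using h1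
  refine ⟨∑ e, n e * z e, ?_⟩
  rw [LinearMap.pi_apply_eq_sum_univ F, Finset.mul_sum]
  push_cast
  refine Finset.sum_congr rfl fun e _ => ?_
  have h3 : (fun j => if e = j then (1 : ℝ) else 0) = Pi.single e 1 := by
    ext j; simp [Pi.single_apply, eq_comm]
  rw [h3, hq, ← hz]
  push_cast
  simp only [smul_eq_mul]; ring

lemma gordan {E ι : Type*} [Fintype E] [DecidableEq E] [Fintype ι]
    (F : ι → ((E → ℝ) →ₗ[ℝ] ℝ))
    (hF : ∀ i e, ∃ q : ℚ, F i (Pi.single e 1) = (q : ℝ)) :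
    ∃ S : Finset (E → ℝ), ∀ x, x ∈ AddSubmonoid.closure (S : Set (E → ℝ)) ↔
      (∃ n : E → ℕ, x = fun e => (n e : ℝ)) ∧ ∀ j, 0 ≤ F j x := by
  choose c hc hz using fun i => clear_denoms (F i) (hF i)
  let cast : (E → ℕ) →+ (E → ℝ) :=
    { toFun := fun n e => (n e : ℝ)
      map_zero' := by ext; simp
      map_add' := by intro a b; ext; simp }
  let pr : ((E → ℕ) × (ι → ℕ)) →+ (E → ℝ) := cast.comp (AddMonoidHom.fst _ _)
  let f : ((E → ℕ) × (ι → ℕ)) →+ (ι → ℝ) :=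
    { toFun := fun p i => (c i : ℝ) * F i (cast p.1)
      map_zero' := by ext; simp
      map_add' := by intro a b; ext; simp [mul_add] }
  let g : ((E → ℕ) × (ι → ℕ)) →+ (ι → ℝ) :=
    { toFun := fun p i => (p.2 i : ℝ)
      map_zero' := by ext; simp
      map_add' := by intro a b; ext; simp }
  obtain ⟨S, hS⟩ := (AddSubmonoid.fg_eqLocusM f g).map pr
  refine ⟨S, fun x => ?_⟩
  rw [hS, AddSubmonoid.mem_map]
  constructor
  · rintro ⟨⟨n, y⟩, hp, rfl⟩
    refine ⟨⟨n, rfl⟩, fun j => ?_⟩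
    have h1 : (c j : ℝ) * F j (cast n) = (y j : ℝ) := congrFun hp j
    have h2 : (0 : ℝ) < c j := by exact_mod_cast hc j
    have h3 : (0 : ℝ) ≤ (c j : ℝ) * F j (cast n) := by rw [h1]; positivity
    exact nonneg_of_mul_nonneg_right h3 h2
  · rintro ⟨⟨n, rfl⟩, hx⟩
    choose z hz' using fun i => hz i n
    refine ⟨(n, fun i => (z i).toNat), ?_, rfl⟩
    change f _ = g _
    ext i
    change (c i : ℝ) * F i (fun e => (n e : ℝ)) = (((z i).toNat : ℕ) : ℝ)
    have h0 : (0 : ℝ) ≤ z i := by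
      rw [← hz' i]; exact mul_nonneg (Nat.cast_nonneg _) (hx i)
    have h1 : ((z i).toNat : ℤ) = z i := Int.toNat_of_nonneg (by exact_mod_cast h0)
    rw [hz' i]
    exact_mod_cast h1.symm

lemma common_mult {ι : Type*} [Fintype ι] (a : ι → ℝ) (ha : ∀ i, ∃ q : ℚ, a i = q) :
    ∃ (P : ℕ) (m : ι → ℕ), 0 < P ∧ (∀ i, 0 < m i) ∧ ∀ i, 0 < a i → (m i : ℝ) * a i = P := by
  classical
  choose q hq using ha
  let N : ι → ℕ := fun i => if 0 < a i then (q i).num.toNat else 1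
  have hpos : ∀ i, 0 < a i → 0 < (q i).num := by
    intro i hi
    rw [hq] at hi
    exact Rat.num_pos.2 (by exact_mod_cast hi)
  have hN : ∀ i, 0 < N i := by
    intro i
    simp only [N]
    split_ifs with h
    · have := hpos i h; omega
    · exact one_pos
  have hP : 0 < ∏ i, N i := Finset.prod_pos fun i _ => hN i
  choose d hd using fun i => Finset.dvd_prod_of_mem N (Finset.mem_univ i)
  have hdpos : ∀ i, 0 < d i := fun i => by
    rcases Nat.eq_zero_or_pos (d i) with h | h
    · have := hd i; rw [h] at this; simp at this; omega
    · exact h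
  refine ⟨∏ i, N i, fun i => (q i).den * d i, hP,
    fun i => Nat.mul_pos (q i).den_pos (hdpos i), fun i hi => ?_⟩
  rw [hd i]
  have h2 : ((q i).den : ℝ) * (q i : ℝ) = (q i).num := by
    exact_mod_cast Rat.den_mul_eq_num (q i)
  have h3 : ((N i : ℕ) : ℝ) = (q i).num := by
    simp only [N, if_pos hi]
    have h1 : ((q i).num.toNat : ℤ) = (q i).num := Int.toNat_of_nonneg (hpos i hi).le
    exact_mod_cast h1
  push_cast
  rw [hq, h3, ← h2]; ring

lemma SupportConnected.congr {Vt E : Type*} {src tgt : E → Vt} {x y : E → ℝ}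
    (hxy : ∀ e, x e ≠ 0 ↔ y e ≠ 0) (hx : SupportConnected src tgt x) :
    SupportConnected src tgt y := by
  unfold SupportConnected at *
  simpa only [hxy] using hx

set_option maxHeartbeats 2000000 in
lemma core {Vt E : Type*} [Fintype E] [DecidableEq E]
    (src tgt : E → Vt) (V : Set (E → ℝ)) (hV : IsRationalPolyhedralCone V)
    (hVpos : V ⊆ {x | ∀ e, 0 ≤ x e})
    (h : (E → ℝ) →ₗ[ℝ] ℝ) (hrat : ∀ e, ∃ q : ℚ, h (Pi.single e 1) = (q : ℝ)) :
    ∃ M p : ℕ, 0 < p ∧ ∀ k0 : ℕ, ∃ T : Set ((E → ℝ) × (E → ℝ)), T.Finite ∧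
      ∀ k : ℕ, M < k → k ≡ k0 [MOD p] →
        (∀ t ∈ T, (k : ℝ) • t.1 + t.2 ∈ Dlevel src tgt V h k) ∧
        ∀ x ∈ Dlevel src tgt V h k, 0 ≤ h x →
          x ∈ convexHull ℝ ((fun t : (E → ℝ) × (E → ℝ) => (k : ℝ) • t.1 + t.2) '' T) + V := by
  classical
  obtain ⟨mm, f, hf, rfl⟩ := hV
  set V : Set (E → ℝ) := {x | ∀ i, 0 ≤ f i x} with hVdef
  have Vadd : ∀ x y, x ∈ V → y ∈ V → x + y ∈ V := fun x y hx hy i => by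
    rw [map_add]; exact add_nonneg (hx i) (hy i)
  have Vsmul : ∀ (c : ℝ) x, 0 ≤ c → x ∈ V → c • x ∈ V := fun c x hc hx i => by
    rw [map_smul]; exact mul_nonneg hc (hx i)
  have V0 : (0 : E → ℝ) ∈ V := fun i => by simp
  have Vsum : ∀ {ι : Type _} (s : Finset ι) (g : ι → E → ℝ), (∀ i ∈ s, g i ∈ V) →
      ∑ i ∈ s, g i ∈ V := fun s g hg i => by
    rw [map_sum]; exact Finset.sum_nonneg fun j hj => hg j hj i
  obtain ⟨S, hS⟩ := gordan (ι := Option (Fin mm)) (fun o => o.elim h f)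
    (by rintro (_ | i) e; exacts [hrat e, hf i e])
  have hS' : ∀ x, x ∈ AddSubmonoid.closure (S : Set (E → ℝ)) ↔
      (∃ n : E → ℕ, x = fun e => (n e : ℝ)) ∧ x ∈ V ∧ 0 ≤ h x := by
    intro x
    rw [hS x, Option.forall]
    simp only [Option.elim, hVdef, Set.mem_ofPred_eq]
    tauto
  have hu : ∀ i : S, (∃ n : E → ℕ, i.1 = fun e => (n e : ℝ)) ∧ i.1 ∈ V ∧ 0 ≤ h i.1 :=
    fun i => (hS' _).1 (AddSubmonoid.subset_closure i.2)
  have hupos : ∀ (i : S) e, 0 ≤ i.1 e := fun i e => hVpos (hu i).2.1 e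
  obtain ⟨P, m, hP, hm, hmP⟩ := common_mult (fun i : S => h i.1) (by
    intro i
    obtain ⟨c, hc, hz⟩ := clear_denoms h hrat
    obtain ⟨n, hn⟩ := (hu i).1
    obtain ⟨z, hz⟩ := hz n
    refine ⟨(z : ℚ) / c, ?_⟩
    rw [hn]
    push_cast
    rw [← hz]
    field_simp)
  have hPR : (0 : ℝ) < P := by exact_mod_cast hP
  let R : (S → ℕ) → E → ℝ := fun b => ∑ i : S, (b i : ℝ) • i.1
  have hRmem : ∀ b, R b ∈ AddSubmonoid.closure (S : Set (E → ℝ)) := by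
    intro b
    refine sum_mem fun i _ => ?_
    rw [Nat.cast_smul_eq_nsmul]
    exact nsmul_mem (AddSubmonoid.subset_closure i.2) _
  have hRh : ∀ b, h (R b) = ∑ i : S, (b i : ℝ) * h i.1 := by
    intro b; simp [R, map_sum]
  have hRe : ∀ b e, R b e = ∑ i : S, (b i : ℝ) * i.1 e := by
    intro b e; simp [R, Finset.sum_apply]
  have hRsupp : ∀ b e, R b e ≠ 0 ↔ ∃ i : S, b i ≠ 0 ∧ i.1 e ≠ 0 := by
    intro b e
    rw [hRe, Ne, Finset.sum_eq_zero_iff_of_nonneg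
      (fun i _ => mul_nonneg (Nat.cast_nonneg _) (hupos i e))]
    simp
  obtain ⟨M, hM⟩ := exists_nat_ge (h (R m))
  have hMb : ∀ b, b ≤ m → h (R b) ≤ M := by
    intro b hb
    refine le_trans ?_ hM
    rw [hRh, hRh]
    refine Finset.sum_le_sum fun i _ => mul_le_mul_of_nonneg_right ?_ (hu i).2.2
    exact_mod_cast hb i
  refine ⟨M, P, hP, fun k0 => ?_⟩
  let good : (S → ℕ) → Prop := fun b => b ≤ m ∧ (∃ e, R b e ≠ 0) ∧ SupportConnected src tgt (R b)
  let T1 : Set ((E → ℝ) × (E → ℝ)) := {t | ∃ b, good b ∧ h (R b) = 0 ∧ t = (0, R b)}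
  let pt : (S → ℕ) × S × ℕ → (E → ℝ) × (E → ℝ) := fun t =>
    (((t.2.2 : ℝ) / P) • ((m t.2.1 : ℝ) • t.2.1.1),
      R t.1 - (h (R t.1) / P) • ((m t.2.1 : ℝ) • t.2.1.1))
  let T2 : Set ((E → ℝ) × (E → ℝ)) := {t | ∃ (b : S → ℕ) (i : S) (z : ℕ), good b ∧ 0 < z ∧ z ≤ P ∧
    b i ≠ 0 ∧ 0 < h i.1 ∧ (∃ y : ℤ, (k0 : ℝ) * z - h (R b) = P * y) ∧ t = pt (b, i, z)}
  have hpt : ∀ (k : ℕ) b i z, (k : ℝ) • (pt (b, i, z)).1 + (pt (b, i, z)).2 =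
      R b + (((k : ℝ) * z - h (R b)) / P) • ((m i : ℝ) • i.1) := by
    intro k b i z
    simp only [pt]
    ext e
    simp only [Pi.add_apply, Pi.sub_apply, Pi.smul_apply, smul_eq_mul]
    ring
  have hclass : ∀ (k : ℕ) (z : ℕ) (c : ℝ), k ≡ k0 [MOD P] →
      ((∃ y : ℤ, (k0 : ℝ) * z - c = P * y) ↔ ∃ y : ℤ, (k : ℝ) * z - c = P * y) := by
    intro k z c hk
    obtain ⟨d, hd⟩ := (Nat.modEq_iff_dvd.1 hk)
    have hd' : (k0 : ℝ) - k = P * d := by exact_mod_cast hd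
    constructor
    · rintro ⟨y, hy⟩
      refine ⟨y - d * z, ?_⟩
      push_cast
      linear_combination hy - z * hd'
    · rintro ⟨y, hy⟩
      refine ⟨y + d * z, ?_⟩
      push_cast
      linear_combination hy + z * hd'
  refine ⟨T1 ∪ T2, ?_, ?_⟩
  · refine Set.Finite.union ?_ ?_
    · refine ((Set.finite_Iic m).image (fun b => ((0 : E → ℝ), R b))).subset ?_
      rintro t ⟨b, hb, -, rfl⟩
      exact ⟨b, hb.1, rfl⟩
    · refine (((Set.finite_Iic m).prod ((Set.finite_univ (α := S)).prod
        (Set.finite_Iic P))).image pt).subset ?_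
      rintro t ⟨b, i, z, hb, -, hz, -, -, -, rfl⟩
      exact ⟨(b, i, z), ⟨hb.1, trivial, hz⟩, rfl⟩
  intro k hk hkk0
  have hkM : (M : ℝ) < k := by exact_mod_cast hk
  constructor
  · rintro t (⟨b, hb, hb0, rfl⟩ | ⟨b, i, z, hb, hz0, hzP, hbi, hi, hy, rfl⟩)
    · simp only [smul_zero, zero_add]
      obtain ⟨⟨n, hn⟩, hRV, -⟩ := (hS' _).1 (hRmem b)
      exact ⟨hRV, fun e => ⟨n e, by rw [hn]; simp⟩, ⟨0, by simp [hb0]⟩, hb.2.1, hb.2.2⟩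
    · rw [hpt]
      obtain ⟨y, hy⟩ := (hclass k z _ hkk0).1 hy
      have hq : ((k : ℝ) * z - h (R b)) / P = y := by rw [hy]; field_simp
      have hypos : (0 : ℝ) ≤ y := by
        rw [← hq]
        have h1 := hMb b hb.1
        have h2 : (1 : ℝ) ≤ z := by exact_mod_cast hz0
        have h3 : (k : ℝ) * 1 ≤ k * z := mul_le_mul_of_nonneg_left h2 (Nat.cast_nonneg _)
        exact div_nonneg (by linarith) hPR.le
      obtain ⟨y', rfl⟩ := Int.eq_ofNat_of_zero_le (a := y) (by exact_mod_cast hypos)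
      have hmem : R b + (((k : ℝ) * z - h (R b)) / P) • ((m i : ℝ) • i.1) ∈
          AddSubmonoid.closure (S : Set (E → ℝ)) := by
        rw [hq]
        refine add_mem (hRmem b) ?_
        rw [Int.cast_natCast, Nat.cast_smul_eq_nsmul, Nat.cast_smul_eq_nsmul]
        exact nsmul_mem (nsmul_mem (AddSubmonoid.subset_closure i.2) _) _
      have hsupp : ∀ e, R b e ≠ 0 ↔
          (R b + (((k : ℝ) * z - h (R b)) / P) • ((m i : ℝ) • i.1)) e ≠ 0 := by
        intro e
        have hRnn : 0 ≤ R b e := hVpos ((hS' _).1 (hRmem b)).2.1 e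
        rw [hq]
        simp only [Pi.add_apply, Pi.smul_apply, smul_eq_mul]
        constructor
        · intro h1
          have h2 : 0 < R b e := lt_of_le_of_ne hRnn (Ne.symm h1)
          have h3 : 0 ≤ ((y' : ℤ) : ℝ) * ((m i : ℝ) * i.1 e) :=
            mul_nonneg hypos (mul_nonneg (Nat.cast_nonneg _) (hupos i e))
          exact (by linarith : (0 : ℝ) < _).ne'
        · intro h1 h2
          apply h1
          have h3 : i.1 e = 0 := by
            by_contra h4
            exact (hRsupp b e).2 ⟨i, hbi, h4⟩ h2
          rw [h2, h3]; simp
      obtain ⟨⟨n, hn⟩, hRV, -⟩ := (hS' _).1 hmem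
      refine ⟨hRV, fun e => ⟨n e, by rw [hn]; simp⟩, ⟨z, ?_⟩, ?_, hb.2.2.congr hsupp⟩
      · rw [map_add, map_smul, map_smul, smul_eq_mul, smul_eq_mul, hmP i hi]
        field_simp
        push_cast
        ring
      · obtain ⟨e, he⟩ := hb.2.1
        exact ⟨e, (hsupp e).1 he⟩
  · rintro x ⟨hxV, hxint, ⟨z, hxz⟩, hxne, hxconn⟩ hx0
    have hxmem : x ∈ AddSubmonoid.closure (S : Set (E → ℝ)) := by
      refine (hS' _).2 ⟨?_, hxV, hx0⟩
      choose w hw using hxint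
      refine ⟨fun e => (w e).toNat, ?_⟩
      ext e
      have h1 : 0 ≤ x e := hVpos hxV e
      rw [hw e] at h1
      have h2 : ((w e).toNat : ℤ) = w e := Int.toNat_of_nonneg (by exact_mod_cast h1)
      rw [hw e]
      exact_mod_cast h2.symm
    obtain ⟨n, hn⟩ := AddSubmonoid.mem_closure_finset'.1 hxmem
    have hxR : x = R n := by
      rw [hn]; simp only [R, Nat.cast_smul_eq_nsmul]
    obtain ⟨a, b, hab, hbm, hbn⟩ : ∃ a b : S → ℕ, (∀ i, n i = b i + a i * m i) ∧ b ≤ m ∧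
        ∀ i, n i ≠ 0 ↔ b i ≠ 0 := by
      refine ⟨fun i => (n i - 1) / m i, fun i => if n i = 0 then 0 else (n i - 1) % m i + 1,
        fun i => ?_, fun i => ?_, fun i => ?_⟩
      · have := Nat.mod_add_div (n i - 1) (m i)
        rw [mul_comm] at this
        by_cases h0 : n i = 0
        · simp [h0]
        · simp only [h0, if_false]; omega
      · have := Nat.mod_lt (n i - 1) (hm i)
        dsimp only
        split_ifs <;> omega
      · dsimp only
        by_cases h0 : n i = 0
        · rw [if_pos h0]; exact ⟨fun h1 => absurd h0 h1, fun h1 => absurd rfl h1⟩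
        · rw [if_neg h0]; exact ⟨fun _ => Nat.succ_ne_zero _, fun _ => h0⟩
    have hsupp : ∀ e, x e ≠ 0 ↔ R b e ≠ 0 := by
      intro e
      rw [hxR, hRsupp, hRsupp]; simp only [hbn]
    have hgood : good b := by
      obtain ⟨e, he⟩ := hxne
      exact ⟨hbm, ⟨e, (hsupp e).1 he⟩, hxconn.congr hsupp⟩
    -- decomposition
    let w : S → E → ℝ := fun i => (m i : ℝ) • i.1
    have hwV : ∀ i, w i ∈ V := fun i => Vsmul _ _ (Nat.cast_nonneg _) (hu i).2.1
    let t : Finset S := Finset.univ.filter fun i => 0 < h i.1 ∧ a i ≠ 0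
    have hdec : x = R b + ∑ i : S, (a i : ℝ) • w i := by
      rw [hxR]
      simp only [R, w]
      rw [← Finset.sum_add_distrib]
      refine Finset.sum_congr rfl fun i _ => ?_
      rw [hab i]; push_cast
      rw [smul_smul, add_smul]
    have hdec2 : ∑ i : S, (a i : ℝ) • w i = ∑ i ∈ t, (a i : ℝ) • w i +
        ∑ i ∈ Finset.univ.filter (fun i : S => ¬ (0 < h i.1 ∧ a i ≠ 0)), (a i : ℝ) • w i :=
      (Finset.sum_filter_add_sum_filter_not _ _ _).symm
    set y0 := ∑ i ∈ Finset.univ.filter (fun i : S => ¬ (0 < h i.1 ∧ a i ≠ 0)), (a i : ℝ) • w i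
      with hy0
    have hy0V : y0 ∈ V := Vsum _ _ fun i _ => Vsmul _ _ (Nat.cast_nonneg _) (hwV i)
    have hy0h : h y0 = 0 := by
      rw [hy0, map_sum]
      refine Finset.sum_eq_zero fun i hi => ?_
      have h1 := (Finset.mem_filter.1 hi).2
      simp only [w, map_smul, smul_eq_mul]
      by_cases h2 : a i = 0
      · simp [h2]
      · have h3 : h i.1 = 0 := le_antisymm (not_lt.1 fun h4 => h1 ⟨h4, h2⟩) (hu i).2.2
        simp [h3]
    let A : ℕ := ∑ i ∈ t, a i
    have hth : h (∑ i ∈ t, (a i : ℝ) • w i) = P * A := by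
      rw [map_sum]
      simp only [A]
      push_cast
      rw [Finset.mul_sum]
      refine Finset.sum_congr rfl fun i hi => ?_
      have h1 := (Finset.mem_filter.1 hi).2.1
      simp only [w, map_smul, smul_eq_mul]
      rw [hmP i h1]; ring
    have hA : (k : ℝ) * z = h (R b) + P * A := by
      rw [← hxz, hdec, hdec2, map_add, map_add, hth, hy0h]; ring
    have hRb0 : 0 ≤ h (R b) := ((hS' _).1 (hRmem b)).2.2
    have hRbk : h (R b) < k := lt_of_le_of_lt (hMb b hbm) hkM
    have hk0 : (0 : ℝ) < k := lt_of_le_of_lt (Nat.cast_nonneg _) hkM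
    have hz0 : (0 : ℝ) ≤ z := by
      rw [hxz] at hx0
      exact nonneg_of_mul_nonneg_right hx0 hk0
    have hz0' : 0 ≤ z := by exact_mod_cast hz0
    rcases hz0'.eq_or_lt with hz | hz
    · rw [← hz] at hA
      have h1 : (0 : ℝ) ≤ P * A := by positivity
      have h2 : h (R b) = 0 := by
        simp at hA; linarith
      refine Set.mem_add.2 ⟨R b, subset_convexHull ℝ _ ⟨(0, R b), Or.inl ⟨b, hgood, h2, rfl⟩,
        by simp⟩, _, ?_, hdec.symm⟩
      exact Vsum _ _ fun i _ => Vsmul _ _ (Nat.cast_nonneg _) (hwV i)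
    · -- reduce z modulo P to 1..P
      obtain ⟨z', c, hz'0, hz'P, hzc⟩ : ∃ z' c : ℕ, 0 < z' ∧ z' ≤ P ∧ z = z' + c * P := by
        obtain ⟨Z, rfl⟩ := Int.eq_ofNat_of_zero_le hz.le
        refine ⟨(Z - 1) % P + 1, (Z - 1) / P, Nat.succ_pos _, Nat.mod_lt _ hP, ?_⟩
        have := Nat.mod_add_div (Z - 1) P
        rw [mul_comm] at this
        have h3 : 0 < Z := by exact_mod_cast hz
        have h4 : Z = (Z - 1) % P + 1 + (Z - 1) / P * P := by omega
        exact_mod_cast h4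
      have hzc' : (z : ℝ) = z' + c * P := by exact_mod_cast hzc
      let A' : ℝ := ((k : ℝ) * z' - h (R b)) / P
      have hA'P : P * A' = (k : ℝ) * z' - h (R b) := by simp only [A']; field_simp
      have hAA' : (A : ℝ) = A' + k * c := by
        have : (P : ℝ) * A = P * (A' + k * c) := by
          rw [mul_add, hA'P]
          rw [hzc'] at hA
          linear_combination -hA
        exact mul_left_cancel₀ hPR.ne' this
      have hA'pos : 0 < A' := by
        have h2 : (1 : ℝ) ≤ z' := by exact_mod_cast hz'0
        have h3 : (k : ℝ) * 1 ≤ k * z' := mul_le_mul_of_nonneg_left h2 (Nat.cast_nonneg _)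
        exact div_pos (by linarith) hPR
      have hkc : (0 : ℝ) ≤ k * c := by positivity
      have hApos : (0 : ℝ) < A := by linarith
      have hsumA : ∑ i ∈ t, (a i : ℝ) / A = 1 := by
        rw [← Finset.sum_div]
        simp only [A]
        push_cast
        refine div_self ?_
        have := hApos.ne'
        simpa only [A, Nat.cast_sum] using this
      refine Set.mem_add.2 ⟨∑ i ∈ t, ((a i : ℝ) / A) • (R b + A' • w i), ?_,
        (k * c / A : ℝ) • (∑ i ∈ t, (a i : ℝ) • w i) + y0, ?_, ?_⟩
      · refine (convex_convexHull ℝ _).sum_mem (fun i _ => by positivity) hsumA fun i hi => ?_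
        have hit := (Finset.mem_filter.1 hi).2
        refine subset_convexHull ℝ _ ⟨pt (b, i, z'), Or.inr ⟨b, i, z', hgood, hz'0, hz'P, ?_,
          hit.1, ?_, rfl⟩, hpt k b i z'⟩
        · rw [← hbn, hab]
          have := Nat.mul_pos (Nat.pos_of_ne_zero hit.2) (hm i)
          omega
        · refine (hclass k z' _ hkk0).2 ⟨A - k * c, ?_⟩
          push_cast
          rw [hAA', ← hA'P]; ring
      · exact Vadd _ _ (Vsmul _ _ (by positivity)
          (Vsum _ _ fun i _ => Vsmul _ _ (Nat.cast_nonneg _) (hwV i))) hy0V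
      · rw [hdec, hdec2]
        simp only [smul_add, Finset.sum_add_distrib]
        rw [← Finset.sum_smul, hsumA, one_smul, add_assoc, ← add_assoc _ _ y0, Finset.smul_sum,
          ← Finset.sum_add_distrib]
        congr 2
        refine Finset.sum_congr rfl fun i _ => ?_
        generalize w i = wi
        rw [smul_smul, smul_smul, ← add_smul]
        congr 1
        have hAne := hApos.ne'
        rw [div_mul_eq_mul_div, div_mul_eq_mul_div, ← add_div, div_eq_iff hAne]
        linear_combination -(a i : ℝ) * hAA'


/-- For a finite directed graph with edge set `E`, a rational polyhedral cone
`V ⊆ ℝ^E_{≥0}` and a rational linear map `h`, the sets `conv(D_k + V)` are generated by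
finitely many points depending affine-linearly on `k`, for `k > M` in each congruence class
mod `p`. -/
theorem disk_vectors_family {Vt E : Type*} [Fintype Vt] [Fintype E] [DecidableEq E]
    (src tgt : E → Vt) (V : Set (E → ℝ)) (hV : IsRationalPolyhedralCone V)
    (hVpos : V ⊆ {x | ∀ e, 0 ≤ x e})
    (h : (E → ℝ) →ₗ[ℝ] ℝ) (hrat : ∀ e, ∃ q : ℚ, h (Pi.single e 1) = (q : ℝ)) :
    ∃ M p : ℕ, 0 < p ∧ ∀ r : ℕ, r < p →
      ∃ (s : ℕ) (v : Fin s → ℕ → (E → ℝ)),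
        (∀ j, ∃ α β : E → ℝ, ∀ k : ℕ, v j k = fun e => α e * (k : ℝ) + β e) ∧
        (∀ k : ℕ, M < k → k % p = r →
          (∀ j, v j k ∈ V) ∧
          convexHull ℝ (Dlevel src tgt V h k + V) =
            convexHull ℝ ((Set.range fun j => v j k) + V)) := by
  classical
  obtain ⟨M₁, p₁, hp₁, H₁⟩ := core src tgt V hV hVpos h hrat
  obtain ⟨M₂, p₂, hp₂, H₂⟩ := core src tgt V hV hVpos (-h) (fun e => by
    obtain ⟨q, hq⟩ := hrat e
    exact ⟨-q, by simp [hq]⟩)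
  have hneg : ∀ k, Dlevel src tgt V (-h) k = Dlevel src tgt V h k := by
    intro k
    have key : ∀ x, (∃ z : ℤ, (-h) x = (k : ℝ) * z) ↔ ∃ z : ℤ, h x = (k : ℝ) * z := by
      intro x
      constructor
      · rintro ⟨z, hz⟩
        exact ⟨-z, by push_cast; rw [LinearMap.neg_apply] at hz; linarith⟩
      · rintro ⟨z, hz⟩
        exact ⟨-z, by push_cast; rw [LinearMap.neg_apply]; linarith⟩
    ext x
    unfold Dlevel
    simp only [key]
  have hVconv : Convex ℝ V ∧ ∀ x y, x ∈ V → y ∈ V → x + y ∈ V := by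
    obtain ⟨m, f, -, rfl⟩ := hV
    constructor
    · intro x hx y hy a b ha hb _ i
      rw [map_add, map_smul, map_smul]
      exact add_nonneg (mul_nonneg ha (hx i)) (mul_nonneg hb (hy i))
    · intro x y hx hy i
      rw [map_add]
      exact add_nonneg (hx i) (hy i)
  refine ⟨max M₁ M₂, p₁ * p₂, Nat.mul_pos hp₁ hp₂, fun r _ => ?_⟩
  obtain ⟨T₁, hT₁, G₁⟩ := H₁ r
  obtain ⟨T₂, hT₂, G₂⟩ := H₂ r
  have hT := hT₁.union hT₂
  obtain ⟨s, g, hg⟩ : ∃ (s : ℕ) (g : Fin s → (E → ℝ) × (E → ℝ)), Set.range g = T₁ ∪ T₂ := by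
    obtain ⟨s, g, -, hg⟩ := hT.fin_param
    exact ⟨s, g, hg⟩
  refine ⟨s, fun j k => (k : ℝ) • (g j).1 + (g j).2, fun j => ⟨(g j).1, (g j).2, fun k => ?_⟩, ?_⟩
  · ext e; simp [mul_comm]
  intro k hk hkr
  have hmod : k ≡ r [MOD p₁ * p₂] := by
    rw [← hkr]; exact (Nat.mod_modEq _ _).symm
  obtain ⟨A₁, B₁⟩ := G₁ k (lt_of_le_of_lt (le_max_left _ _) hk) (hmod.of_mul_right _)
  obtain ⟨A₂, B₂⟩ := G₂ k (lt_of_le_of_lt (le_max_right _ _) hk) (hmod.of_mul_left _)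
  rw [hneg] at A₂ B₂
  have hD : ∀ j, (k : ℝ) • (g j).1 + (g j).2 ∈ Dlevel src tgt V h k := by
    intro j
    have : g j ∈ T₁ ∪ T₂ := hg ▸ Set.mem_range_self j
    rcases this with h1 | h1
    exacts [A₁ _ h1, A₂ _ h1]
  have hrange : (Set.range fun j => (k : ℝ) • (g j).1 + (g j).2) =
      (fun t : (E → ℝ) × (E → ℝ) => (k : ℝ) • t.1 + t.2) '' (T₁ ∪ T₂) := by
    rw [← hg, ← Set.range_comp]; rfl
  refine ⟨fun j => (hD j).1, Set.Subset.antisymm ?_ ?_⟩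
  · refine convexHull_min ?_ (convex_convexHull ℝ _)
    rw [convexHull_add, hVconv.1.convexHull_eq, hrange]
    rintro _ ⟨x, hx, y, hy, rfl⟩
    have hx' : x ∈ convexHull ℝ ((fun t : (E → ℝ) × (E → ℝ) => (k : ℝ) • t.1 + t.2) ''
        (T₁ ∪ T₂)) + V := by
      rcases le_total 0 (h x) with h0 | h0
      · exact Set.add_subset_add_right (convexHull_mono (Set.image_mono Set.subset_union_left))
          (B₁ x hx h0)
      · exact Set.add_subset_add_right (convexHull_mono (Set.image_mono Set.subset_union_right))
          (B₂ x hx (by rw [LinearMap.neg_apply]; linarith))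
    obtain ⟨c, hc, v, hv, rfl⟩ := hx'
    exact ⟨c, hc, v + y, hVconv.2 _ _ hv hy, (add_assoc _ _ _).symm⟩
  · refine convexHull_mono (Set.add_subset_add_right ?_)
    rintro _ ⟨j, rfl⟩
    exact hD j

end SclPaper
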